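/- Under the even-case construction, the cost of the offline matching satisfies C(π_B) ≤ (k-1)/2 + ε/8; consequently the minimum over all bijections π of C(π) is at most (k-1)/2 + ε/8. -/

import Mathlib

/-!
Even-case construction: k ≥ 2 even, 0 < ε ≤ 1.  Servers s_1,...,s_k at
positions 0,...,k-1 (s_i at position i-1).  ε_i = (ε/8)·2^(i-k) for i < k and
ε_k = 1/2.  Requests (1-indexed): for j = 1,...,k/2,
r_{2j-1} = (k/2 + j - 1) - 1/2 - ε_{2j-1},  r_{2j} = (k/2 - j) - 1/2 + ε_{2j}.
A matching is a function f : ℕ → ℕ sending each request index i ∈ {1,...,k} to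
a server index f i ∈ {1,...,k} (at position f i - 1); its cost is
C(f) = ∑_{i=1}^k |r_i - (f i - 1)|.
-/

/-- `ε_i`: equals `(ε/8)·2^(i-k)` for `i < k` and `1/2` for `i = k`. -/
noncomputable def eps (k : ℕ) (ε : ℝ) (i : ℕ) : ℝ :=
  if i = k then 1 / 2 else ε / 8 * (2 : ℝ) ^ ((i : ℤ) - (k : ℤ))

/-- The request `r_i` (1-indexed, `1 ≤ i ≤ k`): writing `i = 2j-1` or `i = 2j`,
`r_{2j-1} = (k/2 + j - 1) - 1/2 - ε_{2j-1}` and `r_{2j} = (k/2 - j) - 1/2 + ε_{2j}`. -/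
noncomputable def req (k : ℕ) (ε : ℝ) (i : ℕ) : ℝ :=
  if i % 2 = 1 then ((k : ℝ) / 2 + (((i + 1) / 2 : ℕ) : ℝ) - 1) - 1 / 2 - eps k ε i
  else ((k : ℝ) / 2 - ((i / 2 : ℕ) : ℝ)) - 1 / 2 + eps k ε i

/-- Cost of the matching sending request `i` to server `f i` (position `f i - 1`). -/
noncomputable def cost (k : ℕ) (ε : ℝ) (f : ℕ → ℕ) : ℝ :=
  ∑ i ∈ Finset.Icc 1 k, |req k ε i - ((f i : ℝ) - 1)|

/-- The permutation algorithm's matching `π_A`: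
`π_A(2j-1) = k/2 - j + 1`, `π_A(2j) = k/2 + j`. -/
def piA (k : ℕ) (i : ℕ) : ℕ :=
  if i % 2 = 1 then k / 2 - (i + 1) / 2 + 1 else k / 2 + i / 2

/-- The offline matching `π_B`: `π_B(2j-1) = k/2 + j`, `π_B(2j) = k/2 - j + 1`. -/
def piB (k : ℕ) (i : ℕ) : ℕ :=
  if i % 2 = 1 then k / 2 + (i + 1) / 2 else k / 2 - i / 2 + 1

theorem sum_eps_le (n : ℕ) {ε : ℝ} (hε : 0 ≤ ε) :
    ∑ i ∈ Finset.Icc 1 n, eps (n + 1) ε i ≤ ε / 8 := by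
  have geom : ∀ m : ℕ, ∑ i ∈ Finset.Icc 1 m, (2 : ℝ) ^ i = 2 ^ (m + 1) - 2 := by
    intro m
    induction m with
    | zero => norm_num
    | succ m ih => rw [Finset.sum_Icc_succ_top (by omega), ih]; ring
  have eq : ∀ i ∈ Finset.Icc 1 n, eps (n + 1) ε i = ε / 8 / 2 ^ (n + 1) * 2 ^ i := by
    intro i hi
    have hne : i ≠ n + 1 := by have := Finset.mem_Icc.mp hi; omega
    rw [eps, if_neg hne, zpow_sub₀ two_ne_zero, zpow_natCast, zpow_natCast]
    ring
  rw [Finset.sum_congr rfl eq, ← Finset.mul_sum, geom, div_mul_eq_mul_div,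
    div_le_iff₀ (by positivity)]
  exact mul_le_mul_of_nonneg_left (by linarith) (by positivity)

theorem eps_nonneg (k : ℕ) {ε : ℝ} (hε : 0 ≤ ε) (i : ℕ) : 0 ≤ eps k ε i := by
  unfold eps
  split_ifs <;> positivity

theorem req_sub_piB_of_odd {k i : ℕ} (hke : Even k) (ε : ℝ) (hi : i % 2 = 1) :
    req k ε i - ((piB k i : ℝ) - 1) = -(1 / 2 + eps k ε i) := by
  obtain ⟨m, rfl⟩ := hke
  have hm : (m + m) / 2 = m := by omega
  simp only [req, piB, if_pos hi, hm]
  push_cast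
  ring

theorem req_sub_piB_of_even {k i : ℕ} (hke : Even k) (ε : ℝ) (hi : i % 2 = 0) (hik : i ≤ k) :
    req k ε i - ((piB k i : ℝ) - 1) = eps k ε i - 1 / 2 := by
  obtain ⟨m, rfl⟩ := hke
  have hm : (m + m) / 2 = m := by omega
  have hle : i / 2 ≤ m := by omega
  simp only [req, piB, if_neg (show ¬ i % 2 = 1 by omega), hm]
  push_cast [Nat.cast_sub hle]
  ring

theorem abs_req_sub_piB_le {k i : ℕ} (hke : Even k) {ε : ℝ} (hε : 0 ≤ ε) (hik : i ≤ k) :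
    |req k ε i - ((piB k i : ℝ) - 1)| ≤ 1 / 2 + eps k ε i := by
  have h0 := eps_nonneg k hε i
  rcases Nat.mod_two_eq_zero_or_one i with hi | hi
  · rw [req_sub_piB_of_even hke ε hi hik, abs_le]
    constructor <;> linarith
  · rw [req_sub_piB_of_odd hke ε hi, abs_neg, abs_of_nonneg (by linarith)]

theorem cost_piB_le {k : ℕ} (hk : 2 ≤ k) (hke : Even k) {ε : ℝ} (hε : 0 ≤ ε) :
    cost k ε (piB k) ≤ ((k : ℝ) - 1) / 2 + ε / 8 := by
  have last : |req k ε k - ((piB k k : ℝ) - 1)| = 0 := by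
    rw [req_sub_piB_of_even hke ε (Nat.even_iff.mp hke) le_rfl, eps, if_pos rfl, sub_self,
      abs_zero]
  obtain ⟨n, rfl⟩ : ∃ n, k = n + 1 := ⟨k - 1, by omega⟩
  rw [cost, Finset.sum_Icc_succ_top (by omega), last, add_zero]
  calc ∑ i ∈ Finset.Icc 1 n, |req (n + 1) ε i - ((piB (n + 1) i : ℝ) - 1)|
      ≤ ∑ i ∈ Finset.Icc 1 n, (1 / 2 + eps (n + 1) ε i) :=
        Finset.sum_le_sum fun i hi =>
          abs_req_sub_piB_le hke hε (by have := Finset.mem_Icc.mp hi; omega)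
    _ = (n : ℝ) / 2 + ∑ i ∈ Finset.Icc 1 n, eps (n + 1) ε i := by
        rw [Finset.sum_add_distrib, Finset.sum_const, Nat.card_Icc, nsmul_eq_mul,
          Nat.add_sub_cancel]
        ring
    _ ≤ (((n + 1 : ℕ) : ℝ) - 1) / 2 + ε / 8 := by
        have := sum_eps_le n hε
        push_cast
        linarith

theorem bijOn_piB {k : ℕ} (hke : Even k) : Set.BijOn (piB k) (Set.Icc 1 k) (Set.Icc 1 k) := by
  obtain ⟨m, rfl⟩ := hke
  refine ⟨fun i hi => ?_, fun i hi j hj hij => ?_, fun b hb => ?_⟩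
  · simp only [Set.mem_Icc, piB] at *
    split_ifs <;> omega
  · simp only [Set.mem_Icc, piB] at *
    split_ifs at hij <;> omega
  · simp only [Set.mem_Icc, Set.mem_image, piB] at *
    by_cases h : b ≤ m
    · refine ⟨2 * (m - b + 1), by omega, ?_⟩
      rw [if_neg (by omega)]
      omega
    · refine ⟨2 * (b - m) - 1, by omega, ?_⟩
      rw [if_pos (by omega)]
      omega

theorem cost_nonneg (k : ℕ) (ε : ℝ) (f : ℕ → ℕ) : 0 ≤ cost k ε f :=
  Finset.sum_nonneg fun _ _ => abs_nonneg _

/-- Even case: C(π_B) ≤ (k-1)/2 + ε/8, hence the minimum cost over all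
bijections of {1,...,k} is at most (k-1)/2 + ε/8. -/
theorem even_offCost_upper (k : ℕ) (hk : 2 ≤ k) (hke : Even k)
    (ε : ℝ) (hε : 0 < ε) (hε1 : ε ≤ 1) :
    cost k ε (piB k) ≤ ((k : ℝ) - 1) / 2 + ε / 8 ∧
      sInf {c : ℝ | ∃ g : ℕ → ℕ,
          Set.BijOn g (Set.Icc 1 k) (Set.Icc 1 k) ∧ c = cost k ε g} ≤
        ((k : ℝ) - 1) / 2 + ε / 8 := by
  have bdd : BddBelow {c : ℝ | ∃ g : ℕ → ℕ,
      Set.BijOn g (Set.Icc 1 k) (Set.Icc 1 k) ∧ c = cost k ε g} := by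
    refine ⟨0, ?_⟩
    rintro c ⟨g, -, rfl⟩
    exact cost_nonneg k ε g
  have hB := cost_piB_le hk hke hε.le
  exact ⟨hB, (csInf_le bdd ⟨piB k, bijOn_piB hke, rfl⟩).trans hB⟩
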